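/- Let S be a string of length n and let m be a positive integer with m ≤ n ≤ 4m/3. Call a substring S[i .. j] a maximal cubic run if j − i + 1 ≥ m, p := per(S[i .. j]) ≤ m/3, and the periodicity cannot be extended in either direction, i.e., (i = 1 or S[i−1] ≠ S[i−1+p]) and (j = n or S[j+1] ≠ S[j+1−p]). Then there is at most one pair (i, j) such that S[i .. j] is a maximal cubic run; moreover, if such S[i .. j] exists, then it contains S[n−m+1 .. m] as a substring and per(S[i .. j]) = per(S[n−m+1 .. m]). -/

import Mathlib

/-- A string of length `n` is modeled as a function `S : ℕ → α`, read at the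
1-indexed positions `1, …, n`.  A positive integer `p ≤ n` is a *period* of `S`
if `S[i] = S[i+p]` holds for all `1 ≤ i ≤ n - p`. -/
def IsPeriod {α : Type*} (S : ℕ → α) (n p : ℕ) : Prop :=
  1 ≤ p ∧ p ≤ n ∧ ∀ i, 1 ≤ i → i + p ≤ n → S i = S (i + p)

/-- `per(S)`: the minimal period of the length-`n` string `S`. -/
noncomputable def minPer {α : Type*} (S : ℕ → α) (n : ℕ) : ℕ :=
  sInf {p | IsPeriod S n p}

/-- `per(S[i .. j])`: the minimal period of the substring `S[i .. j]`. -/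
noncomputable def subPer {α : Type*} (S : ℕ → α) (i j : ℕ) : ℕ :=
  minPer (fun t => S (i + t - 1)) (j - i + 1)

/-- `S[i .. j]` is a *maximal cubic run* (w.r.t. the length parameter `m`) in the
length-`n` string `S`: it has length at least `m`, period `p := per(S[i .. j]) ≤ m/3`,
and the `p`-periodicity extends neither to the left nor to the right. -/
def IsMaxCubicRun {α : Type*} (S : ℕ → α) (n m i j : ℕ) : Prop :=
  1 ≤ i ∧ i ≤ j ∧ j ≤ n ∧ m ≤ j - i + 1 ∧ subPer S i j ≤ m / 3 ∧
    (i = 1 ∨ S (i - 1) ≠ S (i - 1 + subPer S i j)) ∧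
    (j = n ∨ S (j + 1) ≠ S (j + 1 - subPer S i j))

/-- `p`-periodicity on the interval `[a, b]`. -/
def PerOn {α : Type*} (S : ℕ → α) (a b p : ℕ) : Prop :=
  ∀ x, a ≤ x → x + p ≤ b → S x = S (x + p)

lemma perOn_iff {α : Type*} (S : ℕ → α) (i j p : ℕ) (hi : 1 ≤ i) (hij : i ≤ j) :
    IsPeriod (fun t => S (i + t - 1)) (j - i + 1) p ↔
      1 ≤ p ∧ p ≤ j - i + 1 ∧ PerOn S i j p := by
  unfold IsPeriod PerOn
  refine and_congr_right fun h1 => and_congr_right fun h2 => ⟨fun h x hx hxp => ?_, fun h t ht htp => ?_⟩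
  · have := h (x - i + 1) (by omega) (by omega)
    simp only at this
    rwa [show i + (x - i + 1) - 1 = x by omega,
      show i + (x - i + 1 + p) - 1 = x + p by omega] at this
  · have := h (i + t - 1) (by omega) (by omega)
    simp only
    rwa [show i + (t + p) - 1 = i + t - 1 + p by omega]

lemma subPer_spec {α : Type*} (S : ℕ → α) (i j : ℕ) (hi : 1 ≤ i) (hij : i ≤ j) :
    1 ≤ subPer S i j ∧ subPer S i j ≤ j - i + 1 ∧ PerOn S i j (subPer S i j) := by
  rw [← perOn_iff S i j _ hi hij]
  have hne : {p | IsPeriod (fun t => S (i + t - 1)) (j - i + 1) p}.Nonempty := by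
    refine ⟨j - i + 1, ?_⟩
    refine ⟨by omega, le_refl _, ?_⟩
    intro t h1 h2
    omega
  exact Nat.sInf_mem hne

lemma subPer_le {α : Type*} (S : ℕ → α) (i j p : ℕ) (hi : 1 ≤ i) (hij : i ≤ j)
    (h1 : 1 ≤ p) (h2 : p ≤ j - i + 1) (h3 : PerOn S i j p) : subPer S i j ≤ p := by
  apply Nat.sInf_le
  exact (perOn_iff S i j p hi hij).2 ⟨h1, h2, h3⟩

lemma dvd_of_minimal {α : Type*} (S : ℕ → α) (a b q : ℕ) (hq : 1 ≤ q)
    (hper : PerOn S a b q) (hmin : ∀ r, 1 ≤ r → r < q → ¬ PerOn S a b r) (p : ℕ) :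
    PerOn S a b p → a + p + q ≤ b + 1 → q ∣ p := by
  induction p using Nat.strong_induction_on with
  | _ p ih =>
    intro hp hlen
    rcases Nat.eq_zero_or_pos p with rfl | hpos
    · exact dvd_zero _
    by_cases hlt : p < q
    · exact absurd hp (hmin p hpos hlt)
    · push Not at hlt
      have hd : q ∣ p - q := by
        refine ih (p - q) (by omega) ?_ (by omega)
        intro x hx hxb
        by_cases hxp : x + p ≤ b
        · have e1 := hp x hx hxp
          have e2 := hper (x + (p - q)) (by omega) (by omega)
          rw [show x + (p - q) + q = x + p by omega] at e2
          rw [e1, e2]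
        · have e1 := hper (x - q) (by omega) (by omega)
          have e2 := hp (x - q) (by omega) (by omega)
          rw [show x - q + q = x by omega] at e1
          rw [show x - q + p = x + (p - q) by omega] at e2
          rw [← e1, e2]
      have := Nat.dvd_add hd (dvd_refl q)
      rwa [Nat.sub_add_cancel hlt] at this

lemma perOn_mul {α : Type*} {S : ℕ → α} {a b p : ℕ} (h : PerOn S a b p) (x : ℕ) (hx : a ≤ x)
    (k : ℕ) : x + p * k ≤ b → S x = S (x + p * k) := by
  induction k with
  | zero => intro _; simp
  | succ k ih =>
    intro hk
    rw [Nat.mul_succ] at hk ⊢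
    rw [ih (by omega), h (x + p * k) (by omega) (by omega), Nat.add_assoc]

lemma perOn_modEq {α : Type*} {S : ℕ → α} {a b p : ℕ} (h : PerOn S a b p) {x y : ℕ}
    (hx : a ≤ x) (hxb : x ≤ b) (hy : a ≤ y) (hyb : y ≤ b) (hxy : x ≡ y [MOD p]) :
    S x = S y := by
  wlog hle : x ≤ y generalizing x y
  · exact (this hy hyb hx hxb hxy.symm (by omega)).symm
  obtain ⟨k, hk⟩ := (Nat.modEq_iff_dvd' hle).1 hxy
  have e : y = x + p * k := by omega
  rw [e]
  exact perOn_mul h x hx k (by omega)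

lemma exists_rep (p a x : ℕ) (hp : 1 ≤ p) : ∃ y, a ≤ y ∧ y < a + p ∧ x ≡ y [MOD p] := by
  have hle : a ≤ p * a := Nat.le_mul_of_pos_left a hp
  refine ⟨a + (x + p * a - a) % p, by omega, ?_, ?_⟩
  · have := Nat.mod_lt (x + p * a - a) hp
    omega
  · have h1 : a + (x + p * a - a) % p ≡ a + (x + p * a - a) [MOD p] :=
      (Nat.mod_modEq _ _).add_left a
    rw [show a + (x + p * a - a) = x + p * a by omega] at h1
    have h2 : x + p * a ≡ x [MOD p] := by simp [Nat.ModEq]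
    exact (h1.trans h2).symm

lemma perOn_extend {α : Type*} {S : ℕ → α} {i j a b p q : ℕ} (hia : i ≤ a) (hbj : b ≤ j)
    (hp : 1 ≤ p) (hlen : a + p ≤ b + 1) (hqp : q ∣ p) (h : PerOn S i j p)
    (hq : PerOn S a b q) : PerOn S i j q := by
  intro x hx hxq
  obtain ⟨y, hy1, hy2, hy3⟩ := exists_rep p a x hp
  obtain ⟨z, hz1, hz2, hz3⟩ := exists_rep p a (x + q) hp
  rw [perOn_modEq h hx (by omega) (by omega) (by omega) hy3,
    perOn_modEq h (by omega) hxq (by omega) (by omega) hz3]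
  refine perOn_modEq hq hy1 (by omega) hz1 (by omega) ?_
  have h1 : x + q ≡ x [MOD q] := by simp [Nat.ModEq]
  exact ((hy3.of_dvd hqp).symm.trans h1.symm).trans (hz3.of_dvd hqp)

lemma run_mid {α : Type*} (S : ℕ → α) (n m : ℕ)
    (hm : 1 ≤ m) (hmn : m ≤ n) (hn : 3 * n ≤ 4 * m) (i j : ℕ) (h : IsMaxCubicRun S n m i j) :
    i ≤ n - m + 1 ∧ m ≤ j ∧ subPer S i j = subPer S (n - m + 1) m := by
  obtain ⟨hi, hij, hjn, hlen, hp, -, -⟩ := h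
  obtain ⟨p1, p2, p3⟩ := subPer_spec S i j hi hij
  have hmid : n - m + 1 ≤ m := by omega
  obtain ⟨q1, q2, q3⟩ := subPer_spec S (n - m + 1) m (by omega) hmid
  have hle : subPer S (n - m + 1) m ≤ subPer S i j :=
    subPer_le S _ _ _ (by omega) hmid p1 (by omega)
      (fun x hx hxb => p3 x (by omega) (by omega))
  refine ⟨by omega, by omega, le_antisymm ?_ hle⟩
  have hdvd : subPer S (n - m + 1) m ∣ subPer S i j := by
    refine dvd_of_minimal S (n - m + 1) m _ q1 q3 ?_ _
      (fun x hx hxb => p3 x (by omega) (by omega)) (by omega)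
    intro r hr1 hr2 hr
    have := subPer_le S (n - m + 1) m r (by omega) hmid hr1 (by omega) hr
    omega
  exact subPer_le S i j _ hi hij q1 (by omega)
    (perOn_extend (a := n - m + 1) (b := m) (by omega) (by omega) p1 (by omega) hdvd p3 q3)

lemma run_le {α : Type*} (S : ℕ → α) (n m : ℕ)
    (hm : 1 ≤ m) (hmn : m ≤ n) (hn : 3 * n ≤ 4 * m) (i j k l : ℕ)
    (h : IsMaxCubicRun S n m i j) (h' : IsMaxCubicRun S n m k l) : k ≤ i ∧ l ≤ j := by
  obtain ⟨a1, a2, a3⟩ := run_mid S n m hm hmn hn i j h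
  obtain ⟨b1, b2, b3⟩ := run_mid S n m hm hmn hn k l h'
  obtain ⟨hi, hij, hjn, hlen, hp, hL, hR⟩ := h
  obtain ⟨hi', hij', hjn', hlen', hp', hL', hR'⟩ := h'
  obtain ⟨p1, p2, p3⟩ := subPer_spec S i j hi hij
  obtain ⟨q1, q2, q3⟩ := subPer_spec S k l hi' hij'
  have e : subPer S k l = subPer S i j := by omega
  rw [e] at hL' q3
  constructor
  · by_contra hc
    rcases hL' with h1 | h1
    · omega
    · exact h1 (p3 (k - 1) (by omega) (by omega))
  · by_contra hc
    rcases hR with h1 | h1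
    · omega
    · have := q3 (j + 1 - subPer S i j) (by omega) (by omega)
      rw [Nat.sub_add_cancel (by omega)] at this
      exact h1 this.symm

/-- **Uniqueness of a long cubic run.** If `m ≤ n ≤ 4m/3`, there is at most one maximal
cubic run `S[i .. j]`; moreover any such run contains `S[n-m+1 .. m]` as a substring and
has the same minimal period as `S[n-m+1 .. m]`. -/
theorem max_cubic_run_unique {α : Type*} (S : ℕ → α) (n m : ℕ)
    (hm : 1 ≤ m) (hmn : m ≤ n) (hn : 3 * n ≤ 4 * m) :
    (∀ i₁ j₁ i₂ j₂, IsMaxCubicRun S n m i₁ j₁ → IsMaxCubicRun S n m i₂ j₂ →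
        i₁ = i₂ ∧ j₁ = j₂) ∧
    (∀ i j, IsMaxCubicRun S n m i j →
        i ≤ n - m + 1 ∧ m ≤ j ∧ subPer S i j = subPer S (n - m + 1) m) := by
  refine ⟨fun i₁ j₁ i₂ j₂ h₁ h₂ => ?_, fun i j h => run_mid S n m hm hmn hn i j h⟩
  have h := run_le S n m hm hmn hn _ _ _ _ h₁ h₂
  have h' := run_le S n m hm hmn hn _ _ _ _ h₂ h₁
  omega
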